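/- Assume the anticlustering condition DH holds. Then for every integer q ≥ 0, lim_{n→∞} (r_n w_n)^{−1} P({L_1 > q} ∩ A_1) = ν*(1{L > q}) = P(sup_{j≤−1} |Y_j| ≤ 1, sup_{j≥q} |Y_j| > 1). In particular lim_{q→∞} limsup_{n→∞} P(L_1 > q | A_1) = 0, i.e. the cluster length L_1 is tight under the conditional law P(· | A_1). -/

import Mathlib

open MeasureTheory ProbabilityTheory Filter Topology Asymptotics
open scoped Classical

noncomputable section

namespace ClusterPaper

/-- `ℝ^d` with a norm. -/
abbrev Vec (d : ℕ) : Type := EuclideanSpace ℝ (Fin d)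

variable {d : ℕ} {Ω : Type*} [MeasureSpace Ω]

/-- Indices of exceedances over the level `1` of a sequence. -/
def excIdx (y : ℤ → Vec d) : Set ℤ := {j : ℤ | 1 < ‖y j‖}

/-- First exceedance index over level `1` (junk value if there is none). -/
def firstExc (y : ℤ → Vec d) : ℤ := sInf (excIdx y)

/-- Last exceedance index over level `1` (junk value if there is none). -/
def lastExc (y : ℤ → Vec d) : ℤ := sSup (excIdx y)

/-- Cluster length `L(y)` of a sequence: last exceedance index minus first one plus `1`,
and `0` when there is no exceedance over `1`. -/
def clLen (y : ℤ → Vec d) : ℤ :=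
  if (excIdx y).Nonempty then lastExc y - firstExc y + 1 else 0

/-- The scaled block: coordinates `1,…,r` are `xn⁻¹ • f (k+1), …, xn⁻¹ • f (k+r)`,
padded with zeros elsewhere (identification of finite vectors with elements of `ℓ₀`). -/
def blk (xn : ℝ) (r : ℕ) (k : ℤ) (f : ℤ → Vec d) : ℤ → Vec d :=
  fun j => if 1 ≤ j ∧ j ≤ (r : ℤ) then xn⁻¹ • f (k + j) else 0

/-- Exceedance indices over the threshold `xn` among positions `1,…,r`. -/
def excB (xn : ℝ) (r : ℕ) (f : ℤ → Vec d) : Set ℤ :=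
  {i : ℤ | 1 ≤ i ∧ i ≤ (r : ℤ) ∧ xn < ‖f i‖}

/-- The event `A₁` : some position in `1,…,r` exceeds the threshold. -/
def A1 (X : ℤ → Ω → Vec d) (xn : ℝ) (r : ℕ) : Set Ω :=
  {ω | (excB xn r (fun i => X i ω)).Nonempty}

/-- First exceedance time `t(1)` in the block `1,…,r`. -/
def tmin (X : ℤ → Ω → Vec d) (xn : ℝ) (r : ℕ) (ω : Ω) : ℤ :=
  sInf (excB xn r (fun i => X i ω))

/-- Last exceedance time `t(N₁)` in the block `1,…,r`. -/
def tmax (X : ℤ → Ω → Vec d) (xn : ℝ) (r : ℕ) (ω : Ω) : ℤ :=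
  sSup (excB xn r (fun i => X i ω))

/-- Cluster length `L₁ = t(N₁) - t(1) + 1` on `A₁`, and `0` off `A₁`. -/
def Len (X : ℤ → Ω → Vec d) (xn : ℝ) (r : ℕ) (ω : Ω) : ℤ :=
  if (excB xn r (fun i => X i ω)).Nonempty then tmax X xn r ω - tmin X xn r ω + 1 else 0

/-- `w_n = P(|X_0| > x_n)`. -/
def wseq (X : ℤ → Ω → Vec d) (x : ℕ → ℝ) (n : ℕ) : ℝ :=
  (ℙ {ω | x n < ‖X 0 ω‖}).toReal

/-- The candidate extremal index `θ = P(sup_{j ≤ -1} |Y_j| ≤ 1)`. -/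
def theta (Y : ℤ → Ω → Vec d) : ℝ :=
  (ℙ {ω | ∀ j : ℤ, j ≤ -1 → ‖Y j ω‖ ≤ 1}).toReal

/-- The cluster index `ν*(H) = E[H(Y) 1{sup_{j ≤ -1} |Y_j| ≤ 1}]`. -/
def nuStar (Y : ℤ → Ω → Vec d) (H : (ℤ → Vec d) → ℝ) : ℝ :=
  ∫ ω in {ω | ∀ j : ℤ, j ≤ -1 → ‖Y j ω‖ ≤ 1}, H (fun j => Y j ω) ∂ℙ

/-- Stationarity of the time series. -/
def Stationary (X : ℤ → Ω → Vec d) : Prop :=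
  ∀ k : ℤ, Measure.map (fun ω => (fun j : ℤ => X (j + k) ω)) ℙ =
    Measure.map (fun ω => (fun j : ℤ => X j ω)) ℙ

/-- `X` admits `Y` as its tail process: for all `i ≤ j` and all bounded continuous
functionals depending only on the coordinates `i,…,j`,
`E[H(x⁻¹ X) | |X_0| > x] → E[H(Y)]` as `x → ∞`. -/
def IsTailProcess (X Y : ℤ → Ω → Vec d) : Prop :=
  ∀ i j : ℤ, i ≤ j →
    ∀ H : (ℤ → Vec d) → ℝ, Continuous H → (∃ C, ∀ u, |H u| ≤ C) →
      (∀ u v : ℤ → Vec d, (∀ k : ℤ, i ≤ k → k ≤ j → u k = v k) → H u = H v) →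
      Tendsto (fun x : ℝ =>
          (∫ ω in {ω | x < ‖X 0 ω‖}, H (fun k => x⁻¹ • X k ω) ∂ℙ) /
            (ℙ {ω | x < ‖X 0 ω‖}).toReal)
        atTop (𝓝 (∫ ω, H (fun k => Y k ω) ∂ℙ))

/-- Condition `R(r_n, x_n)`. -/
def condR (X : ℤ → Ω → Vec d) (x : ℕ → ℝ) (r : ℕ → ℕ) : Prop :=
  Tendsto x atTop atTop ∧ Tendsto r atTop atTop ∧
    Tendsto (fun n : ℕ => (n : ℝ) * wseq X x n) atTop atTop ∧
    Tendsto (fun n : ℕ => (r n : ℝ) / (n : ℝ)) atTop (𝓝 0) ∧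
    Tendsto (fun n : ℕ => (r n : ℝ) * wseq X x n) atTop (𝓝 0)

/-- The anticlustering condition `DH(r_n, x_n)` of Davis and Hsing. -/
def condDH (X : ℤ → Ω → Vec d) (x : ℕ → ℝ) (r : ℕ → ℕ) : Prop :=
  ∀ s t : ℝ, 0 < s → 0 < t →
    Tendsto (fun ℓ : ℕ =>
      limsup (fun n : ℕ =>
        (ℙ {ω | (∃ j : ℤ, (ℓ : ℤ) ≤ |j| ∧ |j| ≤ (r n : ℤ) ∧ x n * s < ‖X j ω‖) ∧
              x n * t < ‖X 0 ω‖}).toReal /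
          (ℙ {ω | x n * t < ‖X 0 ω‖}).toReal) atTop)
      atTop (𝓝 0)

/-- The anticlustering condition `S^(γ)(r_n, x_n)`. -/
def condS (X : ℤ → Ω → Vec d) (x : ℕ → ℝ) (r : ℕ → ℕ) (γ : ℝ) : Prop :=
  ∀ s t : ℝ, 0 < s → 0 < t →
    Tendsto (fun ℓ : ℕ =>
      limsup (fun n : ℕ =>
        (wseq X x n)⁻¹ * ∑ i ∈ Finset.Icc ℓ (r n),
          (i : ℝ) ^ γ *
            (ℙ {ω | x n * s < ‖X 0 ω‖ ∧ x n * t < ‖X (i : ℤ) ω‖}).toReal) atTop)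
      atTop (𝓝 0)

/-- Membership in the class `H(γ)` of cluster functionals:
nonnegative, measurable, a.s. continuous w.r.t. the law of the tail process `Y`,
vanishing when all coordinates are `≤ 1` in norm, depending only on the coordinates
between the first and the last exceedance over `1`, and dominated by
`C · L(y)^γ` where `L` is the cluster length. -/
structure MemH (Y : ℤ → Ω → Vec d) (γ : ℝ) (H : (ℤ → Vec d) → ℝ) : Prop where
  meas : Measurable H
  nonneg : ∀ y, 0 ≤ H y
  contAE : ∀ᵐ ω ∂ℙ, ContinuousAt H (fun j => Y j ω)
  vanishes : ∀ y : ℤ → Vec d, (∀ j, ‖y j‖ ≤ 1) → H y = 0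
  window : ∀ y : ℤ → Vec d, (excIdx y).Nonempty →
      H y = H (fun j => if firstExc y ≤ j ∧ j ≤ lastExc y then y j else 0)
  growth : ∃ C : ℝ, ∀ y, H y ≤ C * (clLen y : ℝ) ^ γ

/-- The uniform integrability condition
`lim_ℓ limsup_n (r_n w_n)⁻¹ E[H(x_n⁻¹ X_{1,r_n}) 1{H(x_n⁻¹ X_{1,r_n}) > ℓ}] = 0`. -/
def condUI (X : ℤ → Ω → Vec d) (x : ℕ → ℝ) (r : ℕ → ℕ)
    (H : (ℤ → Vec d) → ℝ) : Prop :=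
  Tendsto (fun ℓ : ℕ =>
    limsup (fun n : ℕ =>
      (∫ ω in {ω' | (ℓ : ℝ) < H (blk (x n) (r n) 0 (fun i => X i ω'))},
          H (blk (x n) (r n) 0 (fun i => X i ω)) ∂ℙ) /
        ((r n : ℝ) * wseq X x n)) atTop)
    atTop (𝓝 0)

/-- The β-mixing coefficient between two σ-fields. -/
def betaMix (μ : Measure Ω) (F G : MeasurableSpace Ω) : ℝ :=
  sSup {b : ℝ | ∃ (N M : ℕ) (A : Fin N → Set Ω) (B : Fin M → Set Ω),
    (∀ i, MeasurableSet[F] (A i)) ∧ (∀ j, MeasurableSet[G] (B j)) ∧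
    (Pairwise fun i i' => Disjoint (A i) (A i')) ∧
    (Pairwise fun j j' => Disjoint (B j) (B j')) ∧
    (⋃ i, A i) = Set.univ ∧ (⋃ j, B j) = Set.univ ∧
    b = 2⁻¹ * ∑ i, ∑ j,
      |(μ (A i ∩ B j)).toReal - (μ (A i)).toReal * (μ (B j)).toReal|}

/-- σ-field generated by `X_i`, `i ≤ k`. -/
def sigmaLE (X : ℤ → Ω → Vec d) (k : ℤ) : MeasurableSpace Ω :=
  ⨆ i ∈ {i : ℤ | i ≤ k}, MeasurableSpace.comap (X i) inferInstance

/-- σ-field generated by `X_i`, `i ≥ k`. -/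
def sigmaGE (X : ℤ → Ω → Vec d) (k : ℤ) : MeasurableSpace Ω :=
  ⨆ i ∈ {i : ℤ | k ≤ i}, MeasurableSpace.comap (X i) inferInstance

/-- β-mixing coefficients `β_ℓ` of the series `X`. -/
def betaCoef (X : ℤ → Ω → Vec d) (ℓ : ℕ) : ℝ :=
  betaMix (ℙ : Measure Ω) (sigmaLE X 0) (sigmaGE X (ℓ : ℤ))

/-- `ℓ`-dependence of the series `X`. -/
def LDep (X : ℤ → Ω → Vec d) (ℓ : ℕ) : Prop :=
  ∀ k : ℤ, Indep (sigmaLE X k) (sigmaGE X (k + (ℓ : ℤ) + 1)) ℙ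

/-- The mixing condition `β(r_n, ℓ_n)`. -/
def condBeta (X : ℤ → Ω → Vec d) (r : ℕ → ℕ) : Prop :=
  ∃ ℓ : ℕ → ℕ, Tendsto ℓ atTop atTop ∧
    Tendsto (fun n : ℕ => (ℓ n : ℝ) / (r n : ℝ)) atTop (𝓝 0) ∧
    Tendsto (fun n : ℕ => ((n : ℝ) / (r n : ℝ)) * betaCoef X (ℓ n)) atTop (𝓝 0)

/-- The disjoint-blocks pseudo-estimator `ν̃*_{n}(H)`. -/
def estim (X : ℤ → Ω → Vec d) (x : ℕ → ℝ) (r : ℕ → ℕ)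
    (H : (ℤ → Vec d) → ℝ) (n : ℕ) (ω : Ω) : ℝ :=
  (∑ j ∈ Finset.range (n / r n),
      H (blk (x n) (r n) ((j : ℤ) * (r n : ℤ)) (fun i => X i ω))) /
    ((n : ℝ) * wseq X x n)

/-- The empirical cluster process `G̃_n(H)`. -/
def Gtil (X : ℤ → Ω → Vec d) (x : ℕ → ℝ) (r : ℕ → ℕ)
    (H : (ℤ → Vec d) → ℝ) (n : ℕ) (ω : Ω) : ℝ :=
  (∑ j ∈ Finset.range (n / r n),
      (H (blk (x n) (r n) ((j : ℤ) * (r n : ℤ)) (fun i => X i ω)) -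
        ∫ ω', H (blk (x n) (r n) ((j : ℤ) * (r n : ℤ)) (fun i => X i ω')) ∂ℙ)) /
    Real.sqrt ((n : ℝ) * wseq X x n)

/-- Convergence in distribution to a centered Gaussian law with variance `v`,
tested against bounded continuous functions. -/
def ConvToGaussian (S : ℕ → Ω → ℝ) (v : NNReal) : Prop :=
  ∀ φ : BoundedContinuousFunction ℝ ℝ,
    Tendsto (fun n => ∫ ω, φ (S n ω) ∂ℙ) atTop (𝓝 (∫ z, φ z ∂(gaussianReal 0 v)))

/-- The value `t_j(N_j)^γ · G(𝕏_j)` of the functional `H = T_max^γ · G` on the `j`-th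
block (`0`-indexed), equal to `0` if the block has no exceedance. -/
def jumpBlockVal (X : ℤ → Ω → Vec d) (x : ℕ → ℝ) (r : ℕ → ℕ) (γ : ℝ)
    (G : (ℤ → Vec d) → ℝ) (n j : ℕ) (ω : Ω) : ℝ :=
  if (excB (x n) (r n) (fun i => X ((j : ℤ) * (r n : ℤ) + i) ω)).Nonempty then
    (((sSup (excB (x n) (r n) (fun i => X ((j : ℤ) * (r n : ℤ) + i) ω)) : ℤ) : ℝ) ^ γ) *
      G (blk (x n) (r n) ((j : ℤ) * (r n : ℤ)) (fun i => X i ω))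
  else 0


/-- The indices at which a sequence exceeds the level `c` in norm. -/
def exceed (c : ℝ) (y : ℤ → Vec d) : Set ℤ := {k | c < ‖y k‖}

/-- A property of sets of integers that depends on the set only through the window `W`. -/
def SeenIn (W : Finset ℤ) (Q : Set ℤ → Prop) : Prop :=
  ∀ S T : Set ℤ, (∀ k ∈ W, k ∈ S ↔ k ∈ T) → (Q S ↔ Q T)

theorem measurableSet_exceed_window {W : Finset ℤ} {Q : Set ℤ → Prop} (hQ : SeenIn W Q) (c : ℝ) :
    MeasurableSet {y : ℤ → Vec d | Q (exceed c y)} := by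
  have hm : Measurable (fun (y : ℤ → Vec d) (k : W) => c < ‖y k‖) := by
    refine measurable_pi_lambda _ fun k => ?_
    exact (measurableSet_lt measurable_const (measurable_pi_apply (k : ℤ)).norm).mem
  have hE : {y : ℤ → Vec d | Q (exceed c y)} = (fun (y : ℤ → Vec d) (k : W) => c < ‖y k‖) ⁻¹'
      {p | Q {k | ∃ h : k ∈ W, p ⟨k, h⟩}} := by
    ext y
    refine hQ _ _ fun k hk => ?_
    simp [exceed, hk]
  rw [hE]
  exact hm (Set.toFinite _).measurableSet

theorem measurableSet_exceed_window_comp {W : Finset ℤ} {Q : Set ℤ → Prop} (hQ : SeenIn W Q)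
    (c : ℝ) {X : ℤ → Ω → Vec d} (hXm : ∀ j, Measurable (X j)) :
    MeasurableSet {ω | Q (exceed c fun k => X k ω)} :=
  (measurable_pi_lambda (fun ω k => X k ω) hXm) (measurableSet_exceed_window hQ c)

theorem Stationary.measureReal_exceed_shift {X : ℤ → Ω → Vec d} (hstat : Stationary X)
    (hXm : ∀ j, Measurable (X j)) {W : Finset ℤ} {Q : Set ℤ → Prop} (hQ : SeenIn W Q)
    (c : ℝ) (i : ℤ) :
    (ℙ : Measure Ω).real {ω | Q (exceed c fun k => X (k + i) ω)} =
      (ℙ : Measure Ω).real {ω | Q (exceed c fun k => X k ω)} := by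
  have hE := measurableSet_exceed_window (d := d) hQ c
  have h := congrArg (fun μ => μ.real {y : ℤ → Vec d | Q (exceed c y)}) (hstat i)
  simp only [measureReal_def] at h
  rw [Measure.map_apply (measurable_pi_lambda _ fun j => hXm _) hE,
    Measure.map_apply (measurable_pi_lambda _ fun j => hXm _) hE] at h
  exact h

theorem seenIn_mem (i : ℤ) : SeenIn {i} (fun S => i ∈ S) :=
  fun S T h => h i (by simp)

theorem Stationary.measureReal_norm_gt {X : ℤ → Ω → Vec d} (hstat : Stationary X)
    (hXm : ∀ j, Measurable (X j)) (c : ℝ) (i : ℤ) :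
    (ℙ : Measure Ω).real {ω | c < ‖X i ω‖} = (ℙ : Measure Ω).real {ω | c < ‖X 0 ω‖} := by
  simpa [exceed] using hstat.measureReal_exceed_shift hXm (seenIn_mem 0) c i

/-- `0` is an exceedance, there is no exceedance in the `a` preceding positions, and there is one
between `q` and `b`. -/
def ClusterAt (q a b : ℤ) (S : Set ℤ) : Prop :=
  0 ∈ S ∧ (∀ j, -a ≤ j → j ≤ -1 → j ∉ S) ∧ ∃ j, q ≤ j ∧ j ≤ b ∧ j ∈ S

theorem seenIn_clusterAt (q a b : ℤ) :
    SeenIn (insert 0 (Finset.Icc (-a) (-1) ∪ Finset.Icc q b)) (ClusterAt q a b) := by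
  intro S T h
  simp only [Finset.mem_insert, Finset.mem_union, Finset.mem_Icc] at h
  refine and_congr (h 0 (.inl rfl)) (and_congr ?_ ?_)
  · exact forall_congr' fun j => forall_congr' fun h1 => forall_congr' fun h2 =>
      not_congr (h j (.inr (.inl ⟨h1, h2⟩)))
  · exact exists_congr fun j => and_congr_right fun h1 => and_congr_right fun h2 =>
      h j (.inr (.inr ⟨h1, h2⟩))

theorem seenIn_exists (ℓ m : ℤ) :
    SeenIn (Finset.Icc (-m) m) (fun S => ∃ j : ℤ, ℓ ≤ |j| ∧ |j| ≤ m ∧ j ∈ S) := by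
  intro S T h
  refine exists_congr fun j => and_congr_right fun _ => and_congr_right fun h2 => h j ?_
  rwa [Finset.mem_Icc, ← abs_le]

theorem ClusterAt.of_ge {q a b a' b' ℓ m : ℤ} {S : Set ℤ} (ha : ℓ ≤ a)
    (hb' : ℓ ≤ b') (hbm : b ≤ m) (ham' : a' ≤ m) (hℓ : 0 < ℓ) (h : ClusterAt q a b S) :
    ClusterAt q a' b' S ∨ ∃ j : ℤ, ℓ ≤ |j| ∧ |j| ≤ m ∧ j ∈ S := by
  obtain ⟨h0, hbef, j, hqj, hjb, hjS⟩ := h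
  by_contra! hcon
  obtain ⟨hC, hfar⟩ := hcon
  refine hC ⟨h0, fun i hi hi1 hiS => ?_, j, hqj, ?_, hjS⟩
  · have h1 : i < -a := by
      by_contra! hlt
      exact hbef i hlt hi1 hiS
    exact hfar i (by rw [abs_of_neg (by lia)]; lia) (by rw [abs_of_neg (by lia)]; lia) hiS
  · by_contra! hlt
    exact hfar j (by rw [abs_of_nonneg (by lia)]; lia) (by rw [abs_of_nonneg (by lia)]; lia) hjS

theorem len_gt_and_mem_A1_iff {Ω : Type*} (X : ℤ → Ω → Vec d) (q r : ℕ) (c : ℝ) (ω : Ω) :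
    ((q : ℤ) < Len X c r ω ∧ ω ∈ A1 X c r) ↔
      ∃ i ∈ Finset.range r, ClusterAt q i (r - 1 - i) (exceed c fun k => X (k + (i + 1)) ω) := by
  set S : Set ℤ := excB c r (fun i => X i ω) with hS
  have hbb : BddBelow S := ⟨1, fun i hi => hi.1⟩
  have hba : BddAbove S := ⟨r, fun i hi => hi.2.1⟩
  constructor
  · rintro ⟨hlen, hne : S.Nonempty⟩
    rw [Len, if_pos hne] at hlen
    have ht : sInf S ∈ S := Int.csInf_mem hne hbb
    have hs : sSup S ∈ S := Int.csSup_mem hne hba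
    change (q : ℤ) < sSup S - sInf S + 1 at hlen
    obtain ⟨i, hi⟩ := Int.eq_ofNat_of_zero_le (sub_nonneg.2 ht.1)
    have hti : sInf S = i + 1 := by lia
    refine ⟨i, Finset.mem_range.2 (by have := ht.2.1; lia), ?_, ?_, sSup S - (i + 1), by lia, ?_, ?_⟩
    · have := ht.2.2
      rw [hti] at this
      simpa [exceed] using this
    · intro j hj hj1 hjS
      have : sInf S ≤ j + (i + 1) := csInf_le hbb ⟨by lia, by have := ht.2.1; lia, hjS⟩
      lia
    · have := hs.2.1
      lia
    · change c < ‖X (sSup S - (i + 1) + (i + 1)) ω‖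
      rw [sub_add_cancel]
      exact hs.2.2
  · rintro ⟨i, hi, h0, hbef, j, hqj, hjb, hj⟩
    rw [Finset.mem_range] at hi
    have hi0 : (i : ℤ) + 1 ∈ S := ⟨by lia, by lia, by simpa [exceed] using h0⟩
    have hj' : j + (i + 1) ∈ S := ⟨by lia, by lia, hj⟩
    have hne : S.Nonempty := ⟨_, hi0⟩
    refine ⟨?_, hne⟩
    rw [Len, if_pos hne]
    change (q : ℤ) < sSup S - sInf S + 1
    have h1 := csInf_le hbb hi0
    have h2 := le_csSup hba hj'
    lia

theorem pairwiseDisjoint_clusterAt {Ω : Type*} (X : ℤ → Ω → Vec d) (q : ℤ) (r : ℕ) (c : ℝ) :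
    (Finset.range r : Set ℕ).PairwiseDisjoint fun i : ℕ =>
      {ω | ClusterAt q i (r - 1 - i) (exceed c fun k => X (k + (i + 1)) ω)} := by
  have key {i j : ℕ} (hij : i < j) {ω : Ω}
      (hi : ClusterAt q i (r - 1 - i) (exceed c fun k => X (k + (i + 1)) ω))
      (hj : ClusterAt q j (r - 1 - j) (exceed c fun k => X (k + (j + 1)) ω)) : False := by
    refine hj.2.1 (i - j) (by lia) (by lia) ?_
    have : (i : ℤ) - j + (j + 1) = 0 + (i + 1) := by ring
    change c < ‖X (i - j + (j + 1)) ω‖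
    rw [this]
    exact hi.1
  intro i _ j _ hij
  refine Set.disjoint_left.2 fun ω hi hj => ?_
  rcases hij.lt_or_gt with h | h
  exacts [key h hi hj, key h hj hi]

theorem A1_subset_len_pos {Ω : Type*} (X : ℤ → Ω → Vec d) (c : ℝ) (r : ℕ) :
    A1 X c r ⊆ {ω | 0 < Len X c r ω} := by
  rintro ω ⟨i, hi⟩
  have h1 : tmin X c r ω ≤ i := csInf_le ⟨1, fun i hi => hi.1⟩ hi
  have h2 : i ≤ tmax X c r ω := le_csSup ⟨r, fun i hi => hi.2.1⟩ hi
  change 0 < Len X c r ω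
  rw [Len, if_pos ⟨i, hi⟩]
  lia

theorem lt_clLen_iff {y : ℤ → Vec d} (q : ℕ) (h0 : 1 < ‖y 0‖) (hneg : ∀ j ≤ -1, ‖y j‖ ≤ 1)
    (hb : BddAbove (excIdx y)) : (q : ℤ) < clLen y ↔ ∃ j : ℤ, (q : ℤ) ≤ j ∧ 1 < ‖y j‖ := by
  have hmem : (0 : ℤ) ∈ excIdx y := h0
  have hlb : (0 : ℤ) ∈ lowerBounds (excIdx y) := fun j hj => by
    by_contra! hlt
    exact (hneg j (by lia)).not_gt hj
  have hfirst : firstExc y = 0 := IsLeast.csInf_eq ⟨hmem, hlb⟩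
  rw [clLen, if_pos ⟨0, hmem⟩, hfirst, sub_zero, Int.lt_add_one_iff]
  constructor
  · exact fun h => ⟨lastExc y, h, Int.csSup_mem ⟨0, hmem⟩ hb⟩
  · rintro ⟨j, hqj, hj⟩
    exact hqj.trans (le_csSup hb hj)

section Tail

variable [IsProbabilityMeasure (ℙ : Measure Ω)] {X Y : ℤ → Ω → Vec d}

theorem IsTailProcess.measureReal_norm_gt_pos (htail : IsTailProcess X Y) (c : ℝ) :
    0 < (ℙ : Measure Ω).real {ω | c < ‖X 0 ω‖} := by
  have h := htail 0 0 le_rfl (fun _ => 1) continuous_const ⟨1, by simp⟩ (by simp)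
  simp only [integral_const, probReal_univ, smul_eq_mul, mul_one, MeasurableSet.univ,
    measureReal_restrict_apply, Set.univ_inter] at h
  obtain ⟨b, hb, hcb⟩ := ((h.eventually_ne one_ne_zero).and (eventually_ge_atTop c)).exists
  have hb' : (ℙ : Measure Ω).real {ω | b < ‖X 0 ω‖} ≠ 0 := by
    intro h0
    simp [h0] at hb
  refine (lt_of_le_of_ne measureReal_nonneg hb'.symm).trans_le (measureReal_mono ?_)
  exact fun ω hω => lt_of_le_of_lt hcb hω

theorem IsTailProcess.isProbabilityMeasure_cond (htail : IsTailProcess X Y) (c : ℝ) :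
    IsProbabilityMeasure ((ℙ : Measure Ω)[|{ω | c < ‖X 0 ω‖}]) := by
  refine cond_isProbabilityMeasure fun h => ?_
  have := htail.measureReal_norm_gt_pos c
  simp [measureReal_def, h] at this

/-- The law of the rescaled window of `X` given an exceedance at time `0`. -/
def condLaw (htail : IsTailProcess X Y) (hXm : ∀ j, Measurable (X j)) (W : Finset ℤ) (c : ℝ) :
    ProbabilityMeasure (W → Vec d) :=
  ⟨((ℙ : Measure Ω)[|{ω | c < ‖X 0 ω‖}]).map (fun ω (k : W) => c⁻¹ • X k ω),
    haveI := htail.isProbabilityMeasure_cond c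
    Measure.isProbabilityMeasure_map
      (measurable_pi_lambda _ fun k : W => (hXm k).const_smul c⁻¹).aemeasurable⟩

/-- The law of a window of `Y`. -/
def windowLaw (hYm : ∀ j, Measurable (Y j)) (W : Finset ℤ) : ProbabilityMeasure (W → Vec d) :=
  ⟨(ℙ : Measure Ω).map (fun ω (k : W) => Y k ω),
    Measure.isProbabilityMeasure_map
      (measurable_pi_lambda _ fun k : W => hYm k).aemeasurable⟩

theorem tendsto_condLaw (htail : IsTailProcess X Y) (hXm : ∀ j, Measurable (X j))
    (hYm : ∀ j, Measurable (Y j)) (W : Finset ℤ) :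
    Tendsto (condLaw htail hXm W) atTop (𝓝 (windowLaw hYm W)) := by
  rw [ProbabilityMeasure.tendsto_iff_forall_integral_tendsto]
  intro f
  obtain ⟨a, ha⟩ := W.bddBelow
  obtain ⟨b, hb⟩ := W.bddAbove
  have h := htail (min a b) (max a b) min_le_max (fun u => f fun k : W => u k) (by fun_prop)
    ⟨‖f‖, fun u => f.norm_coe_le_norm _⟩ (by
      intro u v huv
      congr 1
      funext k
      exact huv k ((min_le_left _ _).trans (ha k.2)) ((hb k.2).trans (le_max_right _ _)))
  have hY : ∫ y, f y ∂(windowLaw hYm W : Measure (W → Vec d)) =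
      ∫ ω, f (fun k : W => Y k ω) ∂ℙ :=
    integral_map (measurable_pi_lambda _ fun k : W => hYm k).aemeasurable
      f.continuous.aestronglyMeasurable
  rw [hY]
  refine h.congr fun c => ?_
  have hX : ∫ y, f y ∂(condLaw htail hXm W c : Measure (W → Vec d)) =
      ∫ ω, f (fun k : W => c⁻¹ • X k ω) ∂((ℙ : Measure Ω)[|{ω | c < ‖X 0 ω‖}]) :=
    integral_map (measurable_pi_lambda _ fun k : W => (hXm k).const_smul c⁻¹).aemeasurable
      f.continuous.aestronglyMeasurable
  rw [hX, ProbabilityTheory.cond, integral_smul_measure, ENNReal.toReal_inv, smul_eq_mul,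
    div_eq_inv_mul]

theorem condLaw_apply (htail : IsTailProcess X Y) (hXm : ∀ j, Measurable (X j)) (W : Finset ℤ)
    (c : ℝ) {E : Set (W → Vec d)} (hE : MeasurableSet E) :
    (condLaw htail hXm W c : Measure (W → Vec d)).real E =
      (ℙ : Measure Ω).real {ω | c < ‖X 0 ω‖ ∧ (fun k : W => c⁻¹ • X k ω) ∈ E} /
        (ℙ : Measure Ω).real {ω | c < ‖X 0 ω‖} := by
  have hm : Measurable (fun ω (k : W) => c⁻¹ • X k ω) :=
    measurable_pi_lambda _ fun k : W => (hXm k).const_smul c⁻¹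
  change (((ℙ : Measure Ω)[|{ω | c < ‖X 0 ω‖}]).map (fun ω (k : W) => c⁻¹ • X k ω)).real E = _
  rw [measureReal_def, Measure.map_apply hm hE,
    cond_apply (measurableSet_lt measurable_const (hXm 0).norm), ENNReal.toReal_mul,
    ENNReal.toReal_inv, ← div_eq_inv_mul]
  rfl

theorem eventually_lt_condLaw (htail : IsTailProcess X Y) (hXm : ∀ j, Measurable (X j))
    (hYm : ∀ j, Measurable (Y j)) (W : Finset ℤ) {E : Set (W → Vec d)} (hE : IsOpen E) {p : ℝ}
    (hp0 : 0 ≤ p) (hp : p < (ℙ : Measure Ω).real {ω | (fun k : W => Y k ω) ∈ E}) :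
    ∀ᶠ c in atTop, p * (ℙ : Measure Ω).real {ω | c < ‖X 0 ω‖} <
      (ℙ : Measure Ω).real {ω | c < ‖X 0 ω‖ ∧ (fun k : W => c⁻¹ • X k ω) ∈ E} := by
  have hl := ProbabilityMeasure.le_liminf_measure_open_of_tendsto
    (tendsto_condLaw htail hXm hYm W) hE
  have hY : (windowLaw hYm W : Measure (W → Vec d)) E = ℙ {ω | (fun k : W => Y k ω) ∈ E} :=
    Measure.map_apply (measurable_pi_lambda _ fun k : W => hYm k) hE.measurableSet
  rw [hY] at hl
  have hlt : ENNReal.ofReal p < ℙ {ω | (fun k : W => Y k ω) ∈ E} :=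
    (ENNReal.ofReal_lt_iff_lt_toReal hp0 (measure_ne_top _ _)).2 hp
  filter_upwards [eventually_lt_of_lt_liminf (hlt.trans_le hl)] with c hc
  have := htail.measureReal_norm_gt_pos c
  rw [← lt_div_iff₀ this, ← condLaw_apply htail hXm W c hE.measurableSet]
  exact (ENNReal.ofReal_lt_iff_lt_toReal hp0 (measure_ne_top _ _)).1 hc

theorem eventually_lt_norm_gt_mul (htail : IsTailProcess X Y) (hXm : ∀ j, Measurable (X j))
    (hYm : ∀ j, Measurable (Y j)) {p b : ℝ} (hp0 : 0 ≤ p)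
    (hp : p < (ℙ : Measure Ω).real {ω | b < ‖Y 0 ω‖}) :
    ∀ᶠ c in atTop, p * (ℙ : Measure Ω).real {ω | c < ‖X 0 ω‖} <
      (ℙ : Measure Ω).real {ω | c * b < ‖X 0 ω‖} := by
  have hopen : IsOpen {z : ({0} : Finset ℤ) → Vec d | b < ‖z ⟨0, by simp⟩‖} :=
    isOpen_lt continuous_const (by fun_prop)
  filter_upwards [eventually_lt_condLaw htail hXm hYm {0} hopen hp0 hp, eventually_gt_atTop 0]
    with c hc hc0
  refine hc.trans_le (measureReal_mono ?_)
  rintro ω ⟨-, h⟩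
  simpa [norm_smul, abs_of_pos hc0, lt_inv_mul_iff₀ hc0] using h

theorem exists_one_lt_measureReal_norm_gt (hY0 : ∀ᵐ ω ∂(ℙ : Measure Ω), 1 < ‖Y 0 ω‖)
    {p : ℝ} (hp : p < 1) :
    ∃ b : ℝ, 1 < b ∧ p < (ℙ : Measure Ω).real {ω | b < ‖Y 0 ω‖} := by
  have hmono : Monotone fun n : ℕ => {ω | 1 + 1 / ((n : ℝ) + 1) < ‖Y 0 ω‖} := by
    intro m n hmn ω hω
    refine lt_of_le_of_lt ?_ (show 1 + 1 / ((m : ℝ) + 1) < ‖Y 0 ω‖ from hω)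
    have := Nat.one_div_le_one_div (α := ℝ) hmn
    gcongr
  have hU : (ℙ : Measure Ω) (⋃ n : ℕ, {ω | 1 + 1 / ((n : ℝ) + 1) < ‖Y 0 ω‖}) = 1 := by
    rw [← measure_univ (μ := (ℙ : Measure Ω))]
    refine measure_congr (eventuallyEq_univ.2 ?_)
    filter_upwards [hY0] with ω hω
    obtain ⟨n, hn⟩ := exists_nat_one_div_lt (sub_pos.2 hω)
    exact Set.mem_iUnion.2 ⟨n, show 1 + 1 / ((n : ℝ) + 1) < ‖Y 0 ω‖ by linarith⟩
  have h := tendsto_measure_iUnion_atTop (μ := (ℙ : Measure Ω)) hmono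
  rw [hU] at h
  have h' := (ENNReal.tendsto_toReal ENNReal.one_ne_top).comp h
  obtain ⟨n, hn⟩ := (h'.eventually_const_lt (by simpa using hp)).exists
  exact ⟨1 + 1 / ((n : ℝ) + 1), by simp; positivity, hn⟩

theorem measure_norm_eq_one (hstat : Stationary X) (htail : IsTailProcess X Y)
    (hXm : ∀ j, Measurable (X j)) (hYm : ∀ j, Measurable (Y j))
    (hY0 : ∀ᵐ ω ∂(ℙ : Measure Ω), 1 < ‖Y 0 ω‖) (j : ℤ) :
    (ℙ : Measure Ω) {ω | ‖Y j ω‖ = 1} = 0 := by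
  rw [← measureReal_eq_zero_iff]
  refine le_antisymm (le_of_forall_pos_le_add fun ε hε => ?_) measureReal_nonneg
  set δ : ℝ := min (1 / 2) (ε / 3) with hδ
  have hδ0 : 0 < δ := lt_min (by norm_num) (by positivity)
  have hδ1 : δ ≤ 1 / 2 := min_le_left _ _
  have hδε : 3 * δ ≤ ε := by linarith [min_le_right (1 / 2) (ε / 3)]
  obtain ⟨b, hb, hbp⟩ := exists_one_lt_measureReal_norm_gt hY0 (show 1 - δ < 1 by linarith)
  have hb0 : 0 < b := by linarith
  have hopen : IsOpen {z : ({j} : Finset ℤ) → Vec d |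
      b⁻¹ < ‖z ⟨j, by simp⟩‖ ∧ ‖z ⟨j, by simp⟩‖ < b} := by
    have hc : Continuous fun z : ({j} : Finset ℤ) → Vec d => ‖z ⟨j, by simp⟩‖ := by fun_prop
    exact (isOpen_lt continuous_const hc).inter (isOpen_lt hc continuous_const)
  by_contra! hcon
  have hlt : 3 * δ < (ℙ : Measure Ω).real {ω | b⁻¹ < ‖Y j ω‖ ∧ ‖Y j ω‖ < b} := by
    refine (by linarith : 3 * δ < _).trans_le (measureReal_mono ?_)
    rintro ω (hω : ‖Y j ω‖ = 1)
    exact ⟨hω ▸ inv_lt_one_of_one_lt₀ hb, hω ▸ hb⟩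
  have hF := eventually_lt_norm_gt_mul htail hXm hYm (by linarith) hbp
  obtain ⟨c, h1, h2, h3, hc0⟩ :=
    ((eventually_lt_condLaw htail hXm hYm {j} hopen (by positivity) hlt).and
    (hF.and (((tendsto_id.atTop_mul_const (inv_pos.2 hb0)).eventually hF).and
      (eventually_gt_atTop 0)))).exists
  simp only [id, inv_mul_cancel_right₀ hb0.ne'] at h3
  have hsub : (ℙ : Measure Ω).real {ω | c * b⁻¹ < ‖X j ω‖ ∧ ‖X j ω‖ < c * b} ≤
      (ℙ : Measure Ω).real {ω | c * b⁻¹ < ‖X 0 ω‖} - (ℙ : Measure Ω).real {ω | c * b < ‖X 0 ω‖} := by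
    rw [← hstat.measureReal_norm_gt hXm _ j, ← hstat.measureReal_norm_gt hXm (c * b) j,
      ← measureReal_sdiff _ (measurableSet_lt measurable_const (hXm j).norm)]
    · exact measureReal_mono fun ω hω => ⟨hω.1, not_lt.2 hω.2.le⟩
    · rintro ω (hω : c * b < ‖X j ω‖)
      refine lt_of_le_of_lt ?_ hω
      gcongr
      exact (inv_le_one_of_one_le₀ hb.le).trans hb.le
  have h1' : 3 * δ * (ℙ : Measure Ω).real {ω | c < ‖X 0 ω‖} <
      (ℙ : Measure Ω).real {ω | c * b⁻¹ < ‖X j ω‖ ∧ ‖X j ω‖ < c * b} := by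
    refine h1.trans_le (measureReal_mono ?_)
    rintro ω ⟨-, h, h'⟩
    simp only [norm_smul, norm_inv, Real.norm_eq_abs, abs_of_pos hc0, lt_inv_mul_iff₀ hc0,
      inv_mul_lt_iff₀ hc0] at h h'
    exact ⟨h, h'⟩
  have hpos := htail.measureReal_norm_gt_pos c
  set F := (ℙ : Measure Ω).real {ω | c < ‖X 0 ω‖}
  set F' := (ℙ : Measure Ω).real {ω | c * b⁻¹ < ‖X 0 ω‖}
  nlinarith [mul_pos hpos hδ0]

theorem tendsto_exceed_window (hstat : Stationary X) (htail : IsTailProcess X Y)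
    (hXm : ∀ j, Measurable (X j)) (hYm : ∀ j, Measurable (Y j))
    (hY0 : ∀ᵐ ω ∂(ℙ : Measure Ω), 1 < ‖Y 0 ω‖) {W : Finset ℤ} {Q : Set ℤ → Prop}
    (hQ : SeenIn W Q) :
    Tendsto (fun c : ℝ =>
        (ℙ : Measure Ω).real {ω | c < ‖X 0 ω‖ ∧ Q (exceed c fun k => X k ω)} /
          (ℙ : Measure Ω).real {ω | c < ‖X 0 ω‖})
      atTop (𝓝 ((ℙ : Measure Ω).real {ω | Q (exceed 1 fun k => Y k ω)})) := by
  set E : Set (W → Vec d) := {z | Q {k | ∃ h : k ∈ W, 1 < ‖z ⟨k, h⟩‖}}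
  have hm : Measurable (fun (z : W → Vec d) (k : W) => 1 < ‖z k‖) := by
    refine measurable_pi_lambda _ fun k => ?_
    exact (measurableSet_lt measurable_const (measurable_pi_apply k).norm).mem
  have hEm : MeasurableSet E :=
    hm (Set.toFinite {p : W → Prop | Q {k | ∃ h : k ∈ W, p ⟨k, h⟩}}).measurableSet
  have hfr : frontier E ⊆ ⋃ k : W, {z | ‖z k‖ = 1} := by
    intro z hz
    by_contra hne
    simp only [Set.mem_iUnion, Set.mem_ofPred_eq, not_exists] at hne
    have hev : ∀ᶠ z' in 𝓝 z, ∀ k : W, (1 < ‖z' k‖ ↔ 1 < ‖z k‖) := by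
      rw [eventually_all]
      intro k
      have hc : Tendsto (fun z' : W → Vec d => ‖z' k‖) (𝓝 z) (𝓝 ‖z k‖) :=
        Continuous.tendsto (by fun_prop) z
      rcases lt_or_gt_of_ne (hne k) with h | h
      · filter_upwards [hc.eventually_lt_const h] with z' hz'
        exact iff_of_false hz'.not_gt h.not_gt
      · filter_upwards [hc.eventually_const_lt h] with z' hz'
        exact iff_of_true hz' h
    have hev' : ∀ᶠ z' in 𝓝 z, (z' ∈ E ↔ z ∈ E) := by
      filter_upwards [hev] with z' hz'
      exact hQ _ _ fun k hk => by simpa [hk] using hz' ⟨k, hk⟩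
    rw [frontier_eq_closure_inter_closure] at hz
    obtain ⟨u, hu, huE⟩ := ((mem_closure_iff_frequently.1 hz.1).and_eventually hev').exists
    obtain ⟨v, hv, hvE⟩ := ((mem_closure_iff_frequently.1 hz.2).and_eventually hev').exists
    exact hv (hvE.2 (huE.1 hu))
  have hYmap : Measurable (fun ω (k : W) => Y k ω) := measurable_pi_lambda _ fun k : W => hYm k
  have hnull : (windowLaw hYm W : Measure (W → Vec d)) (frontier E) = 0 := by
    refine measure_mono_null hfr (measure_iUnion_null fun k => ?_)
    change (ℙ : Measure Ω).map (fun ω (k : W) => Y k ω) _ = 0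
    rw [Measure.map_apply hYmap (measurableSet_eq_fun (measurable_pi_apply k).norm
      measurable_const)]
    exact measure_norm_eq_one hstat htail hXm hYm hY0 k
  have h := (ENNReal.tendsto_toReal (measure_ne_top _ _)).comp
    (ProbabilityMeasure.tendsto_measure_of_null_frontier_of_tendsto'
      (tendsto_condLaw htail hXm hYm W) hnull)
  have hYE : ((windowLaw hYm W : Measure (W → Vec d)) E).toReal =
      (ℙ : Measure Ω).real {ω | Q (exceed 1 fun k => Y k ω)} := by
    change ((ℙ : Measure Ω).map (fun ω (k : W) => Y k ω) E).toReal = _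
    rw [Measure.map_apply hYmap hEm, measureReal_def]
    congr 2
    ext ω
    exact hQ _ _ fun k hk => by simp [exceed, hk]
  rw [hYE] at h
  refine h.congr' ?_
  filter_upwards [eventually_gt_atTop 0] with c hc
  refine (condLaw_apply htail hXm W c hEm).trans ?_
  congr 2
  ext ω
  refine and_congr_right fun _ => hQ _ _ fun k hk => ?_
  simp [exceed, hk, norm_smul, abs_of_pos hc, lt_inv_mul_iff₀ hc]

theorem eventually_far_exceed_lt {x : ℕ → ℝ} {r : ℕ → ℕ} (hDH : condDH X x r) {ε : ℝ}
    (hε : 0 < ε) :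
    ∀ᶠ ℓ : ℕ in atTop, ∀ᶠ n in atTop,
      (ℙ : Measure Ω).real {ω | x n < ‖X 0 ω‖ ∧
          ∃ j : ℤ, (ℓ : ℤ) ≤ |j| ∧ |j| ≤ (r n : ℤ) ∧ j ∈ exceed (x n) fun k => X k ω} /
        wseq X x n < ε := by
  filter_upwards [(hDH 1 1 one_pos one_pos).eventually_lt_const hε] with ℓ hℓ
  refine (eventually_lt_of_limsup_lt hℓ ⟨1, ?_⟩).mono fun n hn => ?_
  · refine eventually_map.2 (Eventually.of_forall fun n => div_le_one_of_le₀ ?_ ENNReal.toReal_nonneg)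
    exact measureReal_mono fun ω hω => hω.2
  · simp only [mul_one] at hn
    simp only [and_comm (a := x n < _)]
    exact hn

theorem abs_measureReal_sub_le {A B T : Set Ω} (hA : A ⊆ B ∪ T) (hB : B ⊆ A ∪ T) :
    |(ℙ : Measure Ω).real A - (ℙ : Measure Ω).real B| ≤ (ℙ : Measure Ω).real T := by
  have h1 := (measureReal_mono hA).trans (measureReal_union_le (μ := (ℙ : Measure Ω)) B T)
  have h2 := (measureReal_mono hB).trans (measureReal_union_le (μ := (ℙ : Measure Ω)) A T)
  rw [abs_le]
  constructor <;> linarith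

/-- The exceedances of the tail process die out. -/
theorem eventually_tail_exceed_le (hstat : Stationary X) (htail : IsTailProcess X Y)
    (hXm : ∀ j, Measurable (X j)) (hYm : ∀ j, Measurable (Y j))
    (hY0 : ∀ᵐ ω ∂(ℙ : Measure Ω), 1 < ‖Y 0 ω‖) {x : ℕ → ℝ} {r : ℕ → ℕ} (hR : condR X x r)
    (hDH : condDH X x r) {ε : ℝ} (hε : 0 < ε) :
    ∀ᶠ ℓ : ℕ in atTop,
      (ℙ : Measure Ω).real {ω | ∃ j : ℤ, (ℓ : ℤ) ≤ |j| ∧ j ∈ exceed 1 fun k => Y k ω} ≤ ε := by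
  filter_upwards [eventually_far_exceed_lt hDH hε] with ℓ hℓ
  have hm (m : ℕ) : (ℙ : Measure Ω).real
      {ω | ∃ j : ℤ, (ℓ : ℤ) ≤ |j| ∧ |j| ≤ (m : ℤ) ∧ j ∈ exceed 1 fun k => Y k ω} ≤ ε := by
    refine le_of_tendsto ((tendsto_exceed_window hstat htail hXm hYm hY0
      (seenIn_exists ℓ m)).comp hR.1) ?_
    filter_upwards [hℓ, hR.2.1.eventually_ge_atTop m] with n hn hrn
    refine le_trans ?_ hn.le
    refine div_le_div_of_nonneg_right (measureReal_mono ?_) measureReal_nonneg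
    rintro ω ⟨h0, j, h1, h2, h3⟩
    exact ⟨h0, j, h1, by lia, h3⟩
  have hmono : Monotone fun m : ℕ =>
      {ω | ∃ j : ℤ, (ℓ : ℤ) ≤ |j| ∧ |j| ≤ (m : ℤ) ∧ j ∈ exceed 1 fun k => Y k ω} := by
    rintro m m' hmm ω ⟨j, h1, h2, h3⟩
    exact ⟨j, h1, by lia, h3⟩
  refine (measureReal_mono (s₂ := ⋃ m : ℕ,
    {ω | ∃ j : ℤ, (ℓ : ℤ) ≤ |j| ∧ |j| ≤ (m : ℤ) ∧ j ∈ exceed 1 fun k => Y k ω}) ?_).trans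
    (le_of_tendsto ((ENNReal.tendsto_toReal (measure_ne_top _ _)).comp
      (tendsto_measure_iUnion_atTop hmono)) (Eventually.of_forall hm))
  rintro ω ⟨j, h1, h3⟩
  exact Set.mem_iUnion.2 ⟨j.natAbs, j, h1, by simp, h3⟩

theorem ae_bddAbove_exceed (hstat : Stationary X) (htail : IsTailProcess X Y)
    (hXm : ∀ j, Measurable (X j)) (hYm : ∀ j, Measurable (Y j))
    (hY0 : ∀ᵐ ω ∂(ℙ : Measure Ω), 1 < ‖Y 0 ω‖) {x : ℕ → ℝ} {r : ℕ → ℕ} (hR : condR X x r)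
    (hDH : condDH X x r) :
    ∀ᵐ ω ∂(ℙ : Measure Ω), BddAbove (exceed 1 fun k => Y k ω) := by
  rw [ae_iff, ← measureReal_eq_zero_iff]
  refine le_antisymm (le_of_forall_pos_le_add fun ε hε => ?_) measureReal_nonneg
  obtain ⟨ℓ, hℓ⟩ := (eventually_tail_exceed_le hstat htail hXm hYm hY0 hR hDH hε).exists
  rw [zero_add]
  refine (measureReal_mono ?_).trans hℓ
  rintro ω (hω : ¬ BddAbove _)
  obtain ⟨j, hj, hlj⟩ := not_bddAbove_iff.1 hω ℓ
  exact ⟨j, hlj.le.trans (le_abs_self j), hj⟩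

theorem measureReal_len_gt (hstat : Stationary X) (hXm : ∀ j, Measurable (X j)) (q r : ℕ)
    (c : ℝ) :
    (ℙ : Measure Ω).real ({ω | (q : ℤ) < Len X c r ω} ∩ A1 X c r) =
      ∑ i ∈ Finset.range r,
        (ℙ : Measure Ω).real {ω | ClusterAt q i (r - 1 - i) (exceed c fun k => X k ω)} := by
  have hset : {ω | (q : ℤ) < Len X c r ω} ∩ A1 X c r = ⋃ i ∈ Finset.range r,
      {ω | ClusterAt q i (r - 1 - i) (exceed c fun k => X (k + (i + 1)) ω)} := by
    ext ω
    simpa using len_gt_and_mem_A1_iff X q r c ω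
  rw [hset, measureReal_biUnion_finset (pairwiseDisjoint_clusterAt X (q : ℤ) r c) fun i _ =>
    measurableSet_exceed_window_comp (seenIn_clusterAt _ _ _) c fun j => hXm (j + (i + 1))]
  exact Finset.sum_congr rfl fun i _ =>
    hstat.measureReal_exceed_shift hXm (seenIn_clusterAt _ _ _) c (i + 1)

theorem abs_measureReal_len_gt_sub_le (hstat : Stationary X) (hXm : ∀ j, Measurable (X j))
    (q r ℓ : ℕ) (hℓ : 0 < ℓ) (hℓr : ℓ ≤ r) (c : ℝ) :
    |(ℙ : Measure Ω).real ({ω | (q : ℤ) < Len X c r ω} ∩ A1 X c r) -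
        r * (ℙ : Measure Ω).real {ω | ClusterAt q ℓ ℓ (exceed c fun k => X k ω)}| ≤
      r * (ℙ : Measure Ω).real {ω | c < ‖X 0 ω‖ ∧
          ∃ j : ℤ, (ℓ : ℤ) ≤ |j| ∧ |j| ≤ (r : ℤ) ∧ j ∈ exceed c fun k => X k ω} +
        2 * ℓ * (ℙ : Measure Ω).real {ω | c < ‖X 0 ω‖} := by
  set D := (ℙ : Measure Ω).real {ω | c < ‖X 0 ω‖ ∧
    ∃ j : ℤ, (ℓ : ℤ) ≤ |j| ∧ |j| ≤ (r : ℤ) ∧ j ∈ exceed c fun k => X k ω}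
  set w := (ℙ : Measure Ω).real {ω | c < ‖X 0 ω‖}
  set p := (ℙ : Measure Ω).real {ω | ClusterAt q ℓ ℓ (exceed c fun k => X k ω)}
  have hsum : (r : ℝ) * p = ∑ i ∈ Finset.range r, p := by simp
  rw [measureReal_len_gt hstat hXm, hsum, ← Finset.sum_sub_distrib]
  have hterm : ∀ i ∈ Finset.range r,
      |(ℙ : Measure Ω).real {ω | ClusterAt q i (r - 1 - i) (exceed c fun k => X k ω)} - p| ≤
        D + if i ∈ Finset.range ℓ ∪ Finset.Ico (r - ℓ) r then w else 0 := by
    intro i hi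
    rw [Finset.mem_range] at hi
    have hD : 0 ≤ D := measureReal_nonneg
    split_ifs with h
    · refine (abs_measureReal_sub_le (T := {ω | c < ‖X 0 ω‖}) ?_ ?_).trans
        (le_add_of_nonneg_left hD)
      · exact fun ω hω => .inr hω.1
      · exact fun ω hω => .inr hω.1
    · simp only [Finset.mem_union, Finset.mem_range, Finset.mem_Ico, not_or, not_and, not_lt] at h
      have hi2 : i < r - ℓ := by
        by_contra! h'
        exact absurd hi (h.2 h').not_gt
      rw [add_zero]
      have hzero {a b : ℤ} {ω : Ω} (hω : ClusterAt q a b (exceed c fun k => X k ω)) :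
        c < ‖X 0 ω‖ := hω.1
      refine abs_measureReal_sub_le (fun ω hω => ?_) (fun ω hω => ?_)
      · exact (ClusterAt.of_ge (by lia) le_rfl (by lia) (by lia) (by lia) hω).imp_right
          fun hj => ⟨hzero hω, hj⟩
      · exact (ClusterAt.of_ge le_rfl (by lia) (by lia) (by lia) (by lia) hω).imp_right
          fun hj => ⟨hzero hω, hj⟩
  refine (Finset.abs_sum_le_sum_abs _ _).trans ((Finset.sum_le_sum hterm).trans ?_)
  rw [Finset.sum_add_distrib, Finset.sum_const, Finset.card_range, nsmul_eq_mul,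
    ← Finset.sum_filter, Finset.sum_const, nsmul_eq_mul]
  have hcard : ((Finset.range r).filter
      (· ∈ Finset.range ℓ ∪ Finset.Ico (r - ℓ) r)).card ≤ 2 * ℓ := by
    refine (Finset.card_le_card (t := Finset.range ℓ ∪ Finset.Ico (r - ℓ) r) fun i hi =>
      (Finset.mem_filter.1 hi).2).trans ((Finset.card_union_le _ _).trans ?_)
    simp only [Finset.card_range, Nat.card_Ico]
    lia
  have hw : 0 ≤ w := measureReal_nonneg
  gcongr
  exact_mod_cast hcard

theorem tendsto_len_gt (hstat : Stationary X) (htail : IsTailProcess X Y)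
    (hXm : ∀ j, Measurable (X j)) (hYm : ∀ j, Measurable (Y j))
    (hY0 : ∀ᵐ ω ∂(ℙ : Measure Ω), 1 < ‖Y 0 ω‖) {x : ℕ → ℝ} {r : ℕ → ℕ} (hR : condR X x r)
    (hDH : condDH X x r) (q : ℕ) :
    Tendsto (fun n : ℕ =>
        (ℙ : Measure Ω).real ({ω | (q : ℤ) < Len X (x n) (r n) ω} ∩ A1 X (x n) (r n)) /
          ((r n : ℝ) * wseq X x n))
      atTop (𝓝 ((ℙ : Measure Ω).real {ω | (∀ j : ℤ, j ≤ -1 → ‖Y j ω‖ ≤ 1) ∧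
          ∃ j : ℤ, (q : ℤ) ≤ j ∧ 1 < ‖Y j ω‖})) := by
  rw [Metric.tendsto_atTop']
  refine fun ε hε => eventually_atTop.1 ?_ |>.imp fun N hN n hn => hN n hn.le
  have hε' : 0 < ε / 4 := by positivity
  obtain ⟨ℓ, hℓY, hℓD, hℓ⟩ := ((eventually_tail_exceed_le hstat htail hXm hYm hY0 hR hDH hε').and
    ((eventually_far_exceed_lt hDH hε').and (eventually_gt_atTop 0))).exists
  have hlim : Tendsto (fun n => (ℙ : Measure Ω).real
        {ω | ClusterAt q ℓ ℓ (exceed (x n) fun k => X k ω)} / wseq X x n) atTop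
      (𝓝 ((ℙ : Measure Ω).real {ω | ClusterAt q ℓ ℓ (exceed 1 fun k => Y k ω)})) := by
    refine ((tendsto_exceed_window hstat htail hXm hYm hY0
      (seenIn_clusterAt q ℓ ℓ)).comp hR.1).congr fun n => ?_
    simp only [Function.comp_apply]
    congr 2
    ext ω
    exact and_iff_right_of_imp fun h => h.1
  have hY : |(ℙ : Measure Ω).real {ω | ClusterAt q ℓ ℓ (exceed 1 fun k => Y k ω)} -
      (ℙ : Measure Ω).real {ω | (∀ j : ℤ, j ≤ -1 → ‖Y j ω‖ ≤ 1) ∧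
          ∃ j : ℤ, (q : ℤ) ≤ j ∧ 1 < ‖Y j ω‖}| ≤ ε / 4 := by
    set A := {ω | ∃ j : ℤ, (ℓ : ℤ) ≤ |j| ∧ j ∈ exceed 1 fun k => Y k ω}
    set N := {ω | ¬ 1 < ‖Y 0 ω‖}
    have hN : (ℙ : Measure Ω).real N = 0 := by rw [measureReal_eq_zero_iff]; exact ae_iff.1 hY0
    refine (abs_measureReal_sub_le (T := A ∪ N) ?_ ?_).trans
      ((measureReal_union_le A N).trans (by rw [hN, add_zero]; exact hℓY))
    · rintro ω ⟨h0, hbef, j, hqj, -, hjS⟩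
      by_cases hA : ω ∈ A
      · exact .inr (.inl hA)
      · refine .inl ⟨fun i hi => not_lt.1 fun hlt => ?_, j, hqj, hjS⟩
        by_cases hi' : -(ℓ : ℤ) ≤ i
        · exact hbef i hi' hi hlt
        · exact hA ⟨i, by rw [abs_of_neg (by lia)]; lia, hlt⟩
    · rintro ω ⟨hbef, j, hqj, hj⟩
      by_cases hA : ω ∈ A
      · exact .inr (.inl hA)
      by_cases h0 : 1 < ‖Y 0 ω‖
      · refine .inl ⟨h0, fun i _ hi hlt => (hbef i hi).not_gt hlt, j, hqj, ?_, hj⟩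
        by_contra! hlt
        exact hA ⟨j, hlt.le.trans (le_abs_self j), hj⟩
      · exact .inr (.inr h0)
  have hrat : Tendsto (fun n => (2 * ℓ : ℝ) / r n) atTop (𝓝 0) :=
    (tendsto_natCast_atTop_atTop.comp hR.2.1).const_div_atTop _
  filter_upwards [hℓD, hlim.eventually (Metric.ball_mem_nhds _ hε'),
    hrat.eventually_lt_const hε', hR.2.1.eventually_ge_atTop ℓ] with n h1 h2 h3 h4
  have hw : 0 < wseq X x n := htail.measureReal_norm_gt_pos (x n)
  have hr : (0 : ℝ) < r n := by exact_mod_cast hℓ.trans_le h4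
  have hmain := abs_measureReal_len_gt_sub_le hstat hXm q (r n) ℓ hℓ h4 (x n)
  have hmain' : |(ℙ : Measure Ω).real ({ω | (q : ℤ) < Len X (x n) (r n) ω} ∩ A1 X (x n) (r n)) /
        (r n * wseq X x n) - (ℙ : Measure Ω).real
          {ω | ClusterAt q ℓ ℓ (exceed (x n) fun k => X k ω)} / wseq X x n| < ε / 4 + ε / 4 := by
    rw [show ∀ a b : ℝ, a / (r n * wseq X x n) - b / wseq X x n =
      (a - r n * b) / (r n * wseq X x n) from fun a b => by field_simp, abs_div,
      abs_of_pos (mul_pos hr hw)]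
    refine (div_le_div_of_nonneg_right hmain (mul_pos hr hw).le).trans_lt ?_
    refine lt_of_eq_of_lt ?_ (add_lt_add h1 h3)
    rw [add_div, mul_div_mul_left _ _ hr.ne']
    congr 1
    exact mul_div_mul_right _ _ hw.ne'
  rw [Real.dist_eq] at h2 ⊢
  rw [abs_lt] at *
  rw [abs_le] at hY
  constructor <;> linarith [hmain'.1, hmain'.2, hY.1, hY.2, h2.1, h2.2]

theorem sum_measureReal_le_mul {G : ℕ → Set Ω} {A : Set Ω} {r ℓ : ℕ}
    (hG : ∀ i, MeasurableSet (G i)) (hGA : ∀ i ∈ Finset.range r, G i ⊆ A)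
    (hdisj : ∀ i j, j < r → i + ℓ ≤ j → Disjoint (G i) (G j)) :
    ∑ i ∈ Finset.range r, (ℙ : Measure Ω).real (G i) ≤ ℓ * (ℙ : Measure Ω).real A := by
  have hcard (ω : Ω) : ((Finset.range r).filter (ω ∈ G ·)).card ≤ ℓ := by
    rcases ((Finset.range r).filter (ω ∈ G ·)).eq_empty_or_nonempty with h | h
    · simp [h]
    · have hi := Finset.mem_filter.1 (Finset.min'_mem _ h)
      set i := Finset.min' _ h
      refine (Finset.card_le_card (t := Finset.Ico i (i + ℓ)) fun j hj => ?_).trans (by simp)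
      refine Finset.mem_Ico.2 ⟨Finset.min'_le _ _ hj, ?_⟩
      by_contra! hle
      obtain ⟨hjr, hjG⟩ := Finset.mem_filter.1 hj
      exact Set.disjoint_left.1 (hdisj i j (Finset.mem_range.1 hjr) hle) hi.2 hjG
  have hmain : ∑ i ∈ Finset.range r, (ℙ : Measure Ω) (G i) ≤ ℓ * (ℙ : Measure Ω) A := by
    calc ∑ i ∈ Finset.range r, (ℙ : Measure Ω) (G i)
        = ∫⁻ ω, ∑ i ∈ Finset.range r, (G i).indicator 1 ω := by
          rw [lintegral_finsetSum _ fun i _ => measurable_one.indicator (hG i)]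
          exact Finset.sum_congr rfl fun i _ => (lintegral_indicator_one (hG i)).symm
      _ ≤ ∫⁻ ω, A.indicator (fun _ => (ℓ : ENNReal)) ω := by
          refine lintegral_mono fun ω => ?_
          by_cases hω : ω ∈ A
          · simp only [Set.indicator_of_mem hω, Set.indicator_apply, Pi.one_apply,
              Finset.sum_boole]
            exact_mod_cast hcard ω
          · rw [Finset.sum_eq_zero fun i hi =>
              Set.indicator_of_notMem (fun h => hω (hGA i hi h)) _]
            exact zero_le
      _ ≤ ℓ * (ℙ : Measure Ω) A := lintegral_indicator_const_le _ _
  have h := ENNReal.toReal_mono (by finiteness) hmain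
  rwa [ENNReal.toReal_sum fun i _ => measure_ne_top _ _, ENNReal.toReal_mul,
    ENNReal.toReal_natCast] at h

theorem le_mul_measureReal_A1 (hstat : Stationary X) (hXm : ∀ j, Measurable (X j))
    (r ℓ : ℕ) (hℓ : 0 < ℓ) (c : ℝ) :
    r * ((ℙ : Measure Ω).real {ω | c < ‖X 0 ω‖} - (ℙ : Measure Ω).real {ω | c < ‖X 0 ω‖ ∧
        ∃ j : ℤ, (ℓ : ℤ) ≤ |j| ∧ |j| ≤ (r : ℤ) ∧ j ∈ exceed c fun k => X k ω}) ≤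
      ℓ * (ℙ : Measure Ω).real (A1 X c r) := by
  set Q : ℕ → Set ℤ → Prop := fun i S => 0 ∈ S ∧ ∀ j : ℤ, ℓ ≤ j → j ≤ r - 1 - i → j ∉ S
  have hQ (i : ℕ) : SeenIn (insert 0 (Finset.Icc (ℓ : ℤ) (r - 1 - i))) (Q i) := by
    intro S T h
    simp only [Finset.mem_insert, Finset.mem_Icc] at h
    exact and_congr (h 0 (.inl rfl)) (forall_congr' fun j => forall_congr' fun h1 =>
      forall_congr' fun h2 => not_congr (h j (.inr ⟨h1, h2⟩)))
  have hle := sum_measureReal_le_mul (r := r) (ℓ := ℓ) (A := A1 X c r)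
    (G := fun i : ℕ => {ω | Q i (exceed c fun k => X (k + (i + 1)) ω)})
    (fun i => measurableSet_exceed_window_comp (hQ i) c fun j => hXm (j + (i + 1)))
    (fun i hi ω hω => ⟨i + 1, by lia, by have := Finset.mem_range.1 hi; lia, by
      simpa [exceed] using hω.1⟩)
    (fun i j hj hij => Set.disjoint_left.2 fun ω hi hj' => by
      refine hi.2 (j - i) (by lia) (by lia) ?_
      have h0 : c < ‖X (0 + (j + 1)) ω‖ := hj'.1
      change c < ‖X (j - i + (i + 1)) ω‖
      rwa [show (j : ℤ) - i + (i + 1) = 0 + (j + 1) by ring])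
  refine le_trans ?_ hle
  have hsum (v : ℝ) : (r : ℝ) * v = ∑ i ∈ Finset.range r, v := by simp
  rw [hsum]
  refine Finset.sum_le_sum fun i _ => ?_
  rw [hstat.measureReal_exceed_shift hXm (hQ i) c (i + 1), sub_le_iff_le_add]
  refine (measureReal_mono fun ω hω => ?_).trans (measureReal_union_le _ _)
  by_cases h : Q i (exceed c fun k => X k ω)
  · exact .inl h
  · refine .inr ⟨hω, ?_⟩
    by_contra! hfar
    refine h ⟨hω, fun j h1 h2 => ?_⟩
    have hj : |j| = j := abs_of_nonneg (by lia)
    exact hfar j (by lia) (by lia)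

theorem nuStar_len_gt (hstat : Stationary X) (htail : IsTailProcess X Y)
    (hXm : ∀ j, Measurable (X j)) (hYm : ∀ j, Measurable (Y j))
    (hY0 : ∀ᵐ ω ∂(ℙ : Measure Ω), 1 < ‖Y 0 ω‖) {x : ℕ → ℝ} {r : ℕ → ℕ} (hR : condR X x r)
    (hDH : condDH X x r) (q : ℕ) :
    nuStar Y (fun y => if (q : ℤ) < clLen y then 1 else 0) =
      (ℙ : Measure Ω).real {ω | (∀ j : ℤ, j ≤ -1 → ‖Y j ω‖ ≤ 1) ∧
          ∃ j : ℤ, (q : ℤ) ≤ j ∧ 1 < ‖Y j ω‖} := by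
  have hA : MeasurableSet {ω | ∀ j : ℤ, j ≤ -1 → ‖Y j ω‖ ≤ 1} :=
    (Measurable.forall fun j => measurable_const.imp
      (measurableSet_le (hYm j).norm measurable_const).mem).setOf
  have hB : MeasurableSet {ω | ∃ j : ℤ, (q : ℤ) ≤ j ∧ 1 < ‖Y j ω‖} :=
    (Measurable.exists fun j => measurable_const.and
      (measurableSet_lt measurable_const (hYm j).norm).mem).setOf
  rw [nuStar, setIntegral_congr_ae (g := {ω | ∃ j : ℤ, (q : ℤ) ≤ j ∧ 1 < ‖Y j ω‖}.indicator 1) hA,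
    integral_indicator_one hB, measureReal_restrict_apply hB, Set.inter_comm]
  · rfl
  · filter_upwards [hY0, ae_bddAbove_exceed hstat htail hXm hYm hY0 hR hDH] with ω h0 hb hω
    rw [Set.indicator_apply]
    exact if_congr (lt_clLen_iff q h0 hω hb) rfl rfl

end Tail

/-- Under `DH`, for every integer `q ≥ 0`,
`(r_n w_n)⁻¹ P({L₁ > q} ∩ A₁) → ν*(1{L > q}) = P(sup_{j≤-1}|Y_j| ≤ 1, sup_{j≥q}|Y_j| > 1)`;
in particular the cluster length is tight under `P(· | A₁)`. -/
theorem stmt_6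
    {d : ℕ} {Ω : Type*} [MeasureSpace Ω] [IsProbabilityMeasure (ℙ : Measure Ω)]
    (X Y : ℤ → Ω → Vec d)
    (hXm : ∀ j, Measurable (X j)) (hYm : ∀ j, Measurable (Y j))
    (hstat : Stationary X) (htail : IsTailProcess X Y)
    (hY0 : ∀ᵐ ω ∂ℙ, 1 < ‖Y 0 ω‖)
    (x : ℕ → ℝ) (r : ℕ → ℕ) (hR : condR X x r)
    (hDH : condDH X x r) :
    (∀ q : ℕ,
      Tendsto (fun n : ℕ =>
          (ℙ ({ω | (q : ℤ) < Len X (x n) (r n) ω} ∩ A1 X (x n) (r n))).toReal /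
            ((r n : ℝ) * wseq X x n))
        atTop (𝓝 ((ℙ {ω | (∀ j : ℤ, j ≤ -1 → ‖Y j ω‖ ≤ 1) ∧
            ∃ j : ℤ, (q : ℤ) ≤ j ∧ 1 < ‖Y j ω‖}).toReal)) ∧
      nuStar Y (fun y => if (q : ℤ) < clLen y then 1 else 0) =
        (ℙ {ω | (∀ j : ℤ, j ≤ -1 → ‖Y j ω‖ ≤ 1) ∧
            ∃ j : ℤ, (q : ℤ) ≤ j ∧ 1 < ‖Y j ω‖}).toReal) ∧
    Tendsto (fun q : ℕ =>
        limsup (fun n : ℕ =>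
          (ℙ ({ω | (q : ℤ) < Len X (x n) (r n) ω} ∩ A1 X (x n) (r n))).toReal /
            (ℙ (A1 X (x n) (r n))).toReal) atTop)
      atTop (𝓝 0) := by
  have hlim := tendsto_len_gt hstat htail hXm hYm hY0 hR hDH
  refine ⟨fun q => ⟨hlim q, nuStar_len_gt hstat htail hXm hYm hY0 hR hDH q⟩, ?_⟩
  set p : ℕ → ℝ := fun q => (ℙ : Measure Ω).real {ω | (∀ j : ℤ, j ≤ -1 → ‖Y j ω‖ ≤ 1) ∧
    ∃ j : ℤ, (q : ℤ) ≤ j ∧ 1 < ‖Y j ω‖}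
  have hA : Tendsto (fun n => (ℙ : Measure Ω).real (A1 X (x n) (r n)) / (r n * wseq X x n))
      atTop (𝓝 (p 0)) := by
    refine (hlim 0).congr fun n => ?_
    rw [Nat.cast_zero, Set.inter_eq_right.2 (A1_subset_len_pos X (x n) (r n))]
  have hpos : 0 < p 0 := by
    obtain ⟨ℓ, hℓD, hℓ⟩ :=
      ((eventually_far_exceed_lt hDH one_half_pos).and (eventually_gt_atTop 0)).exists
    have hℓ' : (0 : ℝ) < ℓ := by exact_mod_cast hℓ
    refine (by positivity : (0 : ℝ) < 1 / 2 / ℓ).trans_le (ge_of_tendsto hA ?_)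
    filter_upwards [hℓD, hR.2.1.eventually_gt_atTop 0] with n hn hr
    have hw : 0 < wseq X x n := htail.measureReal_norm_gt_pos (x n)
    have hr' : (0 : ℝ) < r n := by exact_mod_cast hr
    have hle := le_mul_measureReal_A1 hstat hXm (r n) ℓ hℓ (x n)
    change r n * (wseq X x n - _) ≤ _ at hle
    rw [div_lt_iff₀ hw] at hn
    rw [div_le_div_iff₀ hℓ' (mul_pos hr' hw), mul_comm _ (ℓ : ℝ)]
    refine le_trans ?_ hle
    nlinarith
  have hrat (q : ℕ) : Tendsto (fun n : ℕ =>
      (ℙ : Measure Ω).real ({ω | (q : ℤ) < Len X (x n) (r n) ω} ∩ A1 X (x n) (r n)) /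
        (ℙ : Measure Ω).real (A1 X (x n) (r n))) atTop (𝓝 (p q / p 0)) := by
    refine ((hlim q).div hA hpos.ne').congr' ?_
    filter_upwards [hR.2.1.eventually_gt_atTop 0] with n hr
    have hw : 0 < wseq X x n := htail.measureReal_norm_gt_pos (x n)
    have hr' : (0 : ℝ) < r n := by exact_mod_cast hr
    exact div_div_div_cancel_right₀ (mul_pos hr' hw).ne' _ _
  have hpz : Tendsto p atTop (𝓝 0) := by
    refine tendsto_order.2 ⟨fun a ha => Eventually.of_forall fun q =>
      ha.trans_le measureReal_nonneg, fun a ha => ?_⟩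
    filter_upwards [eventually_tail_exceed_le hstat htail hXm hYm hY0 hR hDH (half_pos ha)]
      with q hq
    refine lt_of_le_of_lt ((measureReal_mono ?_).trans hq) (half_lt_self ha)
    rintro ω ⟨-, j, hqj, hj⟩
    exact ⟨j, hqj.trans (le_abs_self j), hj⟩
  have hfin := hpz.div_const (p 0)
  rw [zero_div] at hfin
  exact hfin.congr fun q => (hrat q).limsup_eq.symm

end ClusterPaper
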